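/- An FSA S = (X, T, X_0, δ, Σ, ℓ) is not (O, T_f)-co-diagnosable if and only if in the concurrent composition CC_A(S; S_1^n, …, S_L^n) = (X', T', X_0', δ'), where each S_i^n is the normal sub-local automaton in location i, there is a transition sequence x_0' →^{s_1'} x_1' →^{t'} x_2' →^{s_2'} x_3' →^{s_3'} x_3' such that x_0' ∈ X_0', x_1', x_2', x_3' ∈ X', s_1', s_2', s_3' ∈ (T')*, t' ∈ T', t'(0) ∈ T_f, and |s_3'(0)| > 0. -/

import Mathlib

namespace DES

/-- Run of a labelled transition system along a finite word of events. -/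
inductive RunRel {S : Type*} {E : Type*} (δ : S → E → S → Prop) : S → List E → S → Prop
  | nil (x : S) : RunRel δ x [] x
  | cons {x y z : S} {e : E} {w : List E} :
      δ x e y → RunRel δ y w z → RunRel δ x (e :: w) z

/-- A labelling function (with `none` playing the role of the empty label ε)
extended to words by concatenation (ε's disappear). -/
def obsW {T : Type*} {Λ : Type*} (ℓ : T → Option Λ) (w : List T) : List Λ :=
  w.filterMap ℓ

/-- A finite-state automaton (FSA) `S = (X, T, X₀, δ, Σ, ℓ)`:
states `X`, events `T`, initial states `init`, transition relation `trans`,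
labels `Λ`, labelling function `lbl` (with `none` = ε, i.e. unobservable). -/
structure FSA (X : Type*) (T : Type*) (Λ : Type*) where
  init : Set X
  trans : Set (X × T × X)
  lbl : T → Option Λ

namespace FSA

variable {X : Type*} {T : Type*} {Λ : Type*}

def step (A : FSA X T Λ) (x : X) (t : T) (y : X) : Prop := (x, t, y) ∈ A.trans

/-- extension of the transition relation to words. -/
def Run (A : FSA X T Λ) : X → List T → X → Prop := RunRel A.step

/-- `L(S)`: finite event sequences generated from initial states. -/
def Lang (A : FSA X T Λ) : Set (List T) := {w | ∃ x0 ∈ A.init, ∃ x, A.Run x0 w x}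

def InfRun (A : FSA X T Λ) (x : ℕ → X) (s : ℕ → T) : Prop :=
  x 0 ∈ A.init ∧ ∀ n, A.step (x n) (s n) (x (n + 1))

/-- `L^ω(S)`: infinite event sequences generated from initial states. -/
def LangW (A : FSA X T Λ) : Set (ℕ → T) := {s | ∃ x, A.InfRun x s}

/-- current-state estimate `M_O(S, σ)` under the observation map `O`. -/
def est (A : FSA X T Λ) (O : T → Option Λ) (σ : List Λ) : Set X :=
  {x | ∃ x0 ∈ A.init, ∃ w : List T, obsW O w = σ ∧ A.Run x0 w x}

/-- `y` is reachable from `x` (by a nonempty word). -/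
def Reach (A : FSA X T Λ) (x y : X) : Prop := ∃ w : List T, w ≠ [] ∧ A.Run x w y

/-- `y` lies on a transition cycle. -/
def OnCycle (A : FSA X T Λ) (y : X) : Prop := ∃ w : List T, w ≠ [] ∧ A.Run y w y

/-- the normal sub-automaton: all faulty transitions removed. -/
def normal (A : FSA X T Λ) (Tf : Set T) : FSA X T Λ :=
  ⟨A.init, {tr | tr ∈ A.trans ∧ tr.2.1 ∉ Tf}, A.lbl⟩

/-- local automaton: same data, re-labelled by a local observation map. -/
def localAut (A : FSA X T Λ) (O : T → Option Λ) : FSA X T Λ :=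
  ⟨A.init, A.trans, O⟩

end FSA

/-- local observation map of an observer with observable event set `To`:
it sees the global label on events of `To` and nothing otherwise. -/
noncomputable def localObs {T : Type*} {Λ : Type*} (ℓ : T → Option Λ) (To : Set T) :
    T → Option Λ :=
  fun t => @ite _ (t ∈ To) (Classical.propDecidable _) (ℓ t) none

/-- the first `n` events of an infinite event sequence. -/
def pre {T : Type*} (s : ℕ → T) (n : ℕ) : List T := (List.range n).map s

/-- `s ∈ T*T_f`: the word `s` ends with a faulty event. -/
def endsFaulty {T : Type*} (Tf : Set T) (s : List T) : Prop :=
  ∃ (s₁ : List T) (t : T), t ∈ Tf ∧ s = s₁ ++ [t]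

/-- `T_f ∈ s`: the word `s` contains a faulty event. -/
def hasFault {T : Type*} (Tf : Set T) (s : List T) : Prop := ∃ t ∈ s, t ∈ Tf

namespace FSA

variable {X : Type*} {T : Type*} {Λ : Type*} {L : ℕ}

/-- O-co-detectability (Definition CoDet). -/
def CoDetectable (A : FSA X T Λ) (O : Fin L → T → Option Λ) : Prop :=
  ∃ k : ℕ, ∀ s ∈ A.LangW, ∃ i : Fin L, ∀ n : ℕ,
    k ≤ (obsW (O i) (pre s n)).length →
    (A.est (O i) (obsW (O i) (pre s n))).ncard = 1

/-- strong detectability (Definition StrDet). -/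
def StronglyDetectable (A : FSA X T Λ) : Prop :=
  ∃ k : ℕ, ∀ s ∈ A.LangW, ∀ n : ℕ,
    k ≤ (obsW A.lbl (pre s n)).length →
    (A.est A.lbl (obsW A.lbl (pre s n))).ncard = 1

/-- (O, T_f)-co-diagnosability (Definition CoDiag). -/
def CoDiagnosable (A : FSA X T Λ) (O : Fin L → T → Option Λ) (Tf : Set T) : Prop :=
  ∃ k : ℕ, ∀ s s' : List T, s ∈ A.Lang → endsFaulty Tf s → s ++ s' ∈ A.Lang →
    k ≤ s'.length →
    ∃ i : Fin L, ∀ s'' ∈ A.Lang, obsW (O i) s'' = obsW (O i) (s ++ s') → hasFault Tf s''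

/-- T_f-diagnosability (Definition Diag). -/
def Diagnosable (A : FSA X T Λ) (Tf : Set T) : Prop :=
  ∃ k : ℕ, ∀ s s' : List T, s ∈ A.Lang → endsFaulty Tf s → s ++ s' ∈ A.Lang →
    k ≤ s'.length →
    ∀ s'' ∈ A.Lang, obsW A.lbl s'' = obsW A.lbl (s ++ s') → hasFault Tf s''

/-- (O, T_f)-co-predictability (Definition CoPred). -/
def CoPredictable (A : FSA X T Λ) (O : Fin L → T → Option Λ) (Tf : Set T) : Prop :=
  ∃ k : ℕ, ∀ s ∈ A.Lang, endsFaulty Tf s →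
    ∃ s' : List T, s' <+: s ∧ ¬ hasFault Tf s' ∧
      ∃ i : Fin L, ∀ u v : List T, u ++ v ∈ A.Lang → obsW (O i) s' = obsW (O i) u →
        ¬ hasFault Tf u → k ≤ v.length → hasFault Tf v

/-- T_f-predictability (Definition Pred). -/
def Predictable (A : FSA X T Λ) (Tf : Set T) : Prop :=
  ∃ k : ℕ, ∀ s ∈ A.Lang, endsFaulty Tf s →
    ∃ s' : List T, s' <+: s ∧ ¬ hasFault Tf s' ∧
      ∀ u v : List T, u ++ v ∈ A.Lang → obsW A.lbl s' = obsW A.lbl u →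
        ¬ hasFault Tf u → k ≤ v.length → hasFault Tf v

end FSA

section CC

variable {T : Type*} {Λ : Type*} {L : ℕ}

/-- labelling extended to `Option T` (with `none` = ε). -/
def obsE (ℓ : T → Option Λ) : Option T → Option Λ := fun t? => t?.bind ℓ

/-- one optional step: `none` = stay put, `some t` = take a `t`-transition. -/
def stepOpt {X : Type*} (tr : Set (X × T × X)) : X → Option T → X → Prop :=
  fun x t? y =>
    match t? with
    | none => x = y
    | some t => (x, t, y) ∈ tr

/-- validity of a composite event of the concurrent composition,
restricted to the "active" local components `act`. -/
def ccEventOn (ℓs : Fin L → T → Option Λ) (act : Fin L → Prop)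
    (t0 : Option T) (ts : Fin L → Option T) : Prop :=
  ((∀ j, act j → obsE (ℓs j) t0 = none) ∧
   (∀ j, act j → obsE (ℓs j) (ts j) = none) ∧
   ((t0 ≠ none ∧ ∀ j, act j → ts j = none) ∨
    (t0 = none ∧ ∃ j, act j ∧ ts j ≠ none ∧ ∀ j', act j' → j' ≠ j → ts j' = none)))
  ∨
  ((∃ j, act j ∧ obsE (ℓs j) t0 ≠ none) ∧
   (∀ l, act l →
     (obsE (ℓs l) t0 = none → ts l = none) ∧
     (obsE (ℓs l) t0 ≠ none → obsE (ℓs l) (ts l) = obsE (ℓs l) t0)))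

/-- validity of a composite event of the concurrent composition. -/
def ccEvent (ℓs : Fin L → T → Option Λ) (t0 : Option T) (ts : Fin L → Option T) : Prop :=
  ccEventOn ℓs (fun _ => True) t0 ts

/-- transition relation of the concurrent composition `CC_A(A0; A 0, …, A (L-1))`. -/
def ccTrans {X0 : Type*} {Xs : Fin L → Type*}
    (A0 : FSA X0 T Λ) (A : ∀ i, FSA (Xs i) T Λ) :
    (X0 × (∀ i, Xs i)) → (Option T × (Fin L → Option T)) → (X0 × (∀ i, Xs i)) → Prop :=
  fun p e q =>
    ccEvent (fun i => (A i).lbl) e.1 e.2 ∧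
    stepOpt A0.trans p.1 e.1 q.1 ∧
    ∀ i, stepOpt (A i).trans (p.2 i) (e.2 i) (q.2 i)

/-- initial states of the concurrent composition. -/
def ccInit {X0 : Type*} {Xs : Fin L → Type*}
    (A0 : FSA X0 T Λ) (A : ∀ i, FSA (Xs i) T Λ) : Set (X0 × (∀ i, Xs i)) :=
  {p | p.1 ∈ A0.init ∧ ∀ i, p.2 i ∈ (A i).init}

end CC

section Dia

/-- events of the ⋄-variant of the concurrent composition: ε, an event of `T`,
or the fresh event ⋄. -/
inductive DEv (T : Type*) where
  | eps : DEv T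
  | ev : T → DEv T
  | dia : DEv T

variable {X : Type*} {T : Type*} {Λ : Type*} {L : ℕ}

def devOf : Option T → DEv T
  | none => DEv.eps
  | some t => DEv.ev t

def devToOpt : DEv T → Option T
  | DEv.ev t => some t
  | _ => none

/-- transition relation of the variant concurrent composition
`CC_A^⋄(S; S_1, …, S_L)` of an FSA `A` with its local automata given by the
local observation maps `O i`.  A local component equal to `none` is the fresh
state ⋄. -/
def diaTrans (A : FSA X T Λ) (O : Fin L → T → Option Λ) :
    (X × (Fin L → Option X)) → (Option T × (Fin L → DEv T)) →
    (X × (Fin L → Option X)) → Prop :=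
  fun p e q =>
    -- an ordinary transition of the concurrent composition (all components in X)
    ((∃ ts : Fin L → Option T,
        (∀ i, e.2 i = devOf (ts i)) ∧
        ccEvent O e.1 ts ∧
        stepOpt A.trans p.1 e.1 q.1 ∧
        (∀ i, ∃ xi yi, p.2 i = some xi ∧ q.2 i = some yi ∧ stepOpt A.trans xi (ts i) yi)))
    ∨
    -- the extra ⋄-transitions, at states with some component differing from the 0-th
    ((∃ i, p.2 i ≠ some p.1) ∧
     (∀ i, p.2 i ≠ some p.1 → e.2 i = DEv.dia ∧ q.2 i = none) ∧
     (∃ ts : Fin L → Option T,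
        (∀ i, p.2 i = some p.1 → e.2 i = devOf (ts i)) ∧
        ((ccEventOn O (fun i => p.2 i = some p.1) e.1 ts ∧
          stepOpt A.trans p.1 e.1 q.1 ∧
          (∀ i, p.2 i = some p.1 → ∃ yi, q.2 i = some yi ∧ stepOpt A.trans p.1 (ts i) yi))
         ∨
         (e.1 = none ∧ q.1 = p.1 ∧
          (∀ i, p.2 i = some p.1 → ts i = none ∧ q.2 i = some p.1)))))

/-- initial states of the variant concurrent composition. -/
def diaInit (A : FSA X T Λ) : Set (X × (Fin L → Option X)) :=
  {p | p.1 ∈ A.init ∧ ∀ i, ∃ z ∈ A.init, p.2 i = some z}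

end Dia

/-- a (possibly partial) deterministic finite automaton. -/
structure PDFA (Q : Type*) (A : Type*) where
  start : Q
  accept : Set Q
  trans : Set (Q × A × Q)
  deterministic : ∀ q a q' q'', (q, a, q') ∈ trans → (q, a, q'') ∈ trans → q' = q''

namespace PDFA

variable {Q : Type*} {A : Type*}

def step (M : PDFA Q A) (q : Q) (a : A) (q' : Q) : Prop := (q, a, q') ∈ M.trans

def Accepts (M : PDFA Q A) (w : List A) : Prop :=
  ∃ q, RunRel M.step M.start w q ∧ q ∈ M.accept

def Acyclic (M : PDFA Q A) : Prop := ¬ ∃ (q : Q) (w : List A), w ≠ [] ∧ RunRel M.step q w q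

def Complete (M : PDFA Q A) : Prop := ∀ q a, ∃ q', (q, a, q') ∈ M.trans

def Deadlock (M : PDFA Q A) (q : Q) : Prop := ∀ a q', (q, a, q') ∉ M.trans

def DeadlockFree (M : PDFA Q A) : Prop := ∀ q, ∃ a q', (q, a, q') ∈ M.trans

end PDFA

end DES
namespace DES

theorem RunRel.append {S E : Type*} {δ : S → E → S → Prop} {x y z : S} {u v : List E}
    (h : RunRel δ x u y) (h' : RunRel δ y v z) : RunRel δ x (u ++ v) z := by
  induction h with
  | nil => simpa using h'
  | cons hd _ ih => exact RunRel.cons hd (ih h')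

theorem RunRel.split {S E : Type*} {δ : S → E → S → Prop} (u v : List E) :
    ∀ {x z : S}, RunRel δ x (u ++ v) z → ∃ y, RunRel δ x u y ∧ RunRel δ y v z := by
  induction u with
  | nil => intro x z h; exact ⟨x, RunRel.nil x, h⟩
  | cons e u ih =>
    intro x z h
    cases h with
    | cons hd ht =>
      obtain ⟨y, h1, h2⟩ := ih ht
      exact ⟨y, RunRel.cons hd h1, h2⟩

theorem pump_cycle {S E F : Type*} [Fintype S] {δ : S → E → S → Prop} (f : E → Option F)
    (p0 q : S) (r : List E) : ∀ (p : S) (V : Finset S), (∃ u, RunRel δ p0 u p) →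
    (∀ v ∈ V, (∃ u, RunRel δ p0 u v) ∧ ∃ c, RunRel δ v c p ∧ c.filterMap f ≠ []) →
    Fintype.card S < (r.filterMap f).length + V.card → RunRel δ p r q →
    ∃ x3 s2 s3, RunRel δ p0 s2 x3 ∧ RunRel δ x3 s3 x3 ∧ s3.filterMap f ≠ [] := by
  classical
  induction r with
  | nil =>
    intro p V _ _ hc _
    have := V.card_le_univ
    simp at hc
    omega
  | cons e r ih =>
    intro p V hp hV hc hr
    cases hr with
    | cons hd ht =>
      rename_i p'
      obtain ⟨u, hu⟩ := hp
      have h1 : RunRel δ p [e] p' := RunRel.cons hd (RunRel.nil _)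
      have hp' : ∃ u, RunRel δ p0 u p' := ⟨_, hu.append h1⟩
      cases hfe : f e with
      | none =>
        refine ih p' V hp' ?_ ?_ ht
        · intro v hv
          obtain ⟨h2, c, hc1, hc2⟩ := hV v hv
          exact ⟨h2, _, hc1.append h1, by simp only [List.filterMap_append]; simp [hc2]⟩
        · simpa [List.filterMap_cons, hfe] using hc
      | some a =>
        by_cases hpV : p ∈ V
        · obtain ⟨_, c, hc1, hc2⟩ := hV p hpV
          exact ⟨p, u, c, hu, hc1, hc2⟩
        · refine ih p' (insert p V) hp' ?_ ?_ ht
          · intro v hv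
            rcases Finset.mem_insert.1 hv with rfl | hv
            · exact ⟨⟨u, hu⟩, [e], h1, by simp [hfe]⟩
            · obtain ⟨h2, c, hc1, hc2⟩ := hV v hv
              exact ⟨h2, _, hc1.append h1, by simp only [List.filterMap_append]; simp [hc2]⟩
          · rw [Finset.card_insert_of_notMem hpV]
            simp only [List.filterMap_cons, hfe, List.length_cons] at hc
            omega

section
variable {X T Λ : Type*} {L : ℕ}

theorem cc_proj0 (A : FSA X T Λ) (B : Fin L → FSA X T Λ) {p q : X × (Fin L → X)}
    {r : List (Option T × (Fin L → Option T))} (h : RunRel (ccTrans A B) p r q) :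
    A.Run p.1 (r.filterMap (fun e => e.1)) q.1 := by
  induction h with
  | nil x => exact RunRel.nil _
  | @cons x y z e w hd _ ih =>
    have h1 := hd.2.1
    cases he : e.1 with
    | none => rw [he] at h1; simp only [stepOpt] at h1; simpa [List.filterMap_cons, he, h1] using ih
    | some t =>
      rw [he] at h1
      simp only [List.filterMap_cons, he]
      exact RunRel.cons h1 ih

theorem cc_proji (A : FSA X T Λ) (B : Fin L → FSA X T Λ) (i : Fin L) {p q : X × (Fin L → X)}
    {r : List (Option T × (Fin L → Option T))} (h : RunRel (ccTrans A B) p r q) :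
    (B i).Run (p.2 i) (r.filterMap (fun e => e.2 i)) (q.2 i) := by
  induction h with
  | nil x => exact RunRel.nil _
  | @cons x y z e w hd _ ih =>
    have h1 := hd.2.2 i
    cases he : e.2 i with
    | none => rw [he] at h1; simp only [stepOpt] at h1; simpa [List.filterMap_cons, he, h1] using ih
    | some t =>
      rw [he] at h1
      simp only [List.filterMap_cons, he]
      exact RunRel.cons h1 ih

theorem cc_obs (A : FSA X T Λ) (B : Fin L → FSA X T Λ) (i : Fin L) {p q : X × (Fin L → X)}
    {r : List (Option T × (Fin L → Option T))} (h : RunRel (ccTrans A B) p r q) :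
    obsW (B i).lbl (r.filterMap (fun e => e.2 i)) =
      obsW (B i).lbl (r.filterMap (fun e => e.1)) := by
  induction h with
  | nil x => rfl
  | @cons x y z e w hd _ ih =>
    have key : obsE (B i).lbl (e.2 i) = obsE (B i).lbl e.1 := by
      rcases hd.1 with ⟨h1, h2, _⟩ | ⟨_, h2⟩
      · rw [h1 i trivial, h2 i trivial]
      · by_cases h3 : obsE (B i).lbl e.1 = none
        · rw [h3, (h2 i trivial).1 h3]; rfl
        · exact (h2 i trivial).2 h3
    simp only [obsW, List.filterMap_filterMap] at ih ⊢
    simp only [List.filterMap_cons]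
    simp only [obsE] at key
    rw [key, ih]

theorem normal_run {A : FSA X T Λ} {Tf : Set T} {x y : X} {w : List T}
    (h : (A.normal Tf).Run x w y) : A.Run x w y ∧ ¬ hasFault Tf w := by
  induction h with
  | nil => exact ⟨RunRel.nil _, by simp [hasFault]⟩
  | cons hd _ ih =>
    refine ⟨RunRel.cons hd.1 ih.1, ?_⟩
    rintro ⟨t, ht, htf⟩
    rcases List.mem_cons.1 ht with rfl | ht
    · exact hd.2 htf
    · exact ih.2 ⟨t, ht, htf⟩

theorem run_normal {A : FSA X T Λ} {Tf : Set T} {x y : X} {w : List T}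
    (h : A.Run x w y) (hw : ¬ hasFault Tf w) : (A.normal Tf).Run x w y := by
  induction h with
  | nil => exact RunRel.nil _
  | cons hd _ ih =>
    refine RunRel.cons ⟨hd, fun h => hw ⟨_, List.mem_cons_self, h⟩⟩ (ih ?_)
    rintro ⟨t, ht, htf⟩
    exact hw ⟨t, List.mem_cons_of_mem _ ht, htf⟩

/-- advance one component silently -/
theorem cc_adv1 (A : FSA X T Λ) (B : Fin L → FSA X T Λ) (i : Fin L) (x : X) {a b : X}
    {u : List T} (h : (B i).Run a u b) (hu : ∀ t ∈ u, (B i).lbl t = none) :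
    ∀ y : Fin L → X, y i = a → ∃ r, RunRel (ccTrans A B) (x, y) r (x, Function.update y i b) ∧
      r.filterMap (fun e => e.1) = [] := by
  induction h with
  | nil a => intro y hy; subst hy; exact ⟨[], by simpa using RunRel.nil _, rfl⟩
  | @cons a c b t w hd _ ih =>
    intro y hy
    obtain ⟨r, h1, h2⟩ := ih (fun t ht => hu t (List.mem_cons_of_mem _ ht))
      (Function.update y i c) (by simp)
    refine ⟨(none, Function.update (fun _ => none) i (some t)) :: r, RunRel.cons (y := (x, Function.update y i c)) ?_ (by simpa using h1), ?_⟩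
    · refine ⟨Or.inl ⟨fun _ _ => rfl, ?_, Or.inr ⟨rfl, i, trivial, by simp, ?_⟩⟩, rfl, ?_⟩
      · intro j _
        by_cases hj : j = i
        · subst hj; simpa [obsE] using hu t List.mem_cons_self
        · simp [hj, obsE]
      · intro j _ hj; simp [hj]
      · intro j
        by_cases hj : j = i
        · subst hj; subst hy; simpa [stepOpt, FSA.step] using hd
        · simp [hj, stepOpt]
    · simpa [List.filterMap_cons] using h2

theorem cc_adv (A : FSA X T Λ) (B : Fin L → FSA X T Λ) (x : X) (y y' : Fin L → X)
    (H : ∀ i, ∃ u, (B i).Run (y i) u (y' i) ∧ ∀ t ∈ u, (B i).lbl t = none) :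
    ∃ r, RunRel (ccTrans A B) (x, y) r (x, y') ∧ r.filterMap (fun e => e.1) = [] := by
  classical
  have key : ∀ s : Finset (Fin L), ∃ r, RunRel (ccTrans A B) (x, y) r
      (x, fun i => if i ∈ s then y' i else y i) ∧ r.filterMap (fun e => e.1) = [] := by
    intro s
    induction s using Finset.induction_on with
    | empty => exact ⟨[], by simpa using RunRel.nil _, rfl⟩
    | insert a s ha ih =>
      obtain ⟨r, h1, h2⟩ := ih
      obtain ⟨u, hu1, hu2⟩ := H a
      obtain ⟨r', h3, h4⟩ := cc_adv1 A B a x hu1 hu2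
        (fun i => if i ∈ s then y' i else y i) (by simp [ha])
      refine ⟨r ++ r', ?_, by rw [List.filterMap_append, h2, h4]; rfl⟩
      convert h1.append h3 using 2
      funext i
      by_cases hi : i = a
      · subst hi; simp
      · simp [hi]
  simpa using key Finset.univ

theorem cc_build (A : FSA X T Λ) (B : Fin L → FSA X T Λ) {x z : X} {w : List T}
    (h : A.Run x w z) : ∀ y : Fin L → X,
    (∀ i, ∃ u v, (B i).Run (y i) u v ∧ obsW (B i).lbl u = obsW (B i).lbl w) →
    ∃ r q, RunRel (ccTrans A B) (x, y) r q ∧ r.filterMap (fun e => e.1) = w := by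
  induction h with
  | nil x => intro y _; exact ⟨[], _, RunRel.nil _, rfl⟩
  | @cons x x' z t w hd _ ih =>
    intro y H
    have H' : ∀ i, ∃ (y1 y2 : X) (o : Option T),
        (∃ u, (B i).Run (y i) u y1 ∧ ∀ t ∈ u, (B i).lbl t = none) ∧
        stepOpt (B i).trans y1 o y2 ∧
        ((B i).lbl t = none → o = none) ∧ obsE (B i).lbl o = (B i).lbl t ∧
        ∃ u v, (B i).Run y2 u v ∧ obsW (B i).lbl u = obsW (B i).lbl w := by
      intro i
      obtain ⟨u, v, h1, h2⟩ := H i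
      cases ho : (B i).lbl t with
      | none =>
        refine ⟨y i, y i, none, ⟨[], RunRel.nil _, by simp⟩, rfl, fun _ => rfl, rfl, u, v, h1, ?_⟩
        simpa [obsW, List.filterMap_cons, ho] using h2
      | some σ =>
        simp only [obsW, List.filterMap_cons, ho] at h2
        obtain ⟨l1, a, l2, rfl, hl1, ha, hl2⟩ := List.filterMap_eq_cons_iff.1 h2
        obtain ⟨y1, h3, h4⟩ := RunRel.split _ _ h1
        cases h4 with
        | cons h5 h6 =>
          exact ⟨y1, _, some a, ⟨l1, h3, hl1⟩, h5, by simp, ha, l2, v, h6, hl2⟩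
    choose y1 y2 o h1 h2 h3 h4 h5 using H'
    obtain ⟨r1, hr1, hr1'⟩ := cc_adv A B x y y1 h1
    obtain ⟨r2, q, hr2, hr2'⟩ := ih y2 h5
    refine ⟨r1 ++ (some t, o) :: r2, q, hr1.append (RunRel.cons (y := (x', y2)) ⟨?_, hd, h2⟩ hr2), ?_⟩
    · by_cases hex : ∃ j, (B j).lbl t ≠ none
      · obtain ⟨j, hj⟩ := hex
        exact Or.inr ⟨⟨j, trivial, hj⟩, fun l _ => ⟨h3 l, fun _ => h4 l⟩⟩
      · push Not at hex
        exact Or.inl ⟨fun j _ => hex j, fun j _ => (h4 j).trans (hex j),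
          Or.inl ⟨by simp, fun j _ => h3 j (hex j)⟩⟩
    · rw [List.filterMap_append, hr1']
      simp [hr2']

theorem run_iter {S E F : Type*} {δ : S → E → S → Prop} {x : S} {c : List E} (f : E → Option F)
    (h : RunRel δ x c x) (hc : c.filterMap f ≠ []) (k : ℕ) :
    ∃ r, RunRel δ x r x ∧ k ≤ (r.filterMap f).length := by
  induction k with
  | zero => exact ⟨[], RunRel.nil _, by simp⟩
  | succ k ih =>
    obtain ⟨r, h1, h2⟩ := ih
    refine ⟨c ++ r, h.append h1, ?_⟩
    have := List.length_pos_of_ne_nil hc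
    rw [List.filterMap_append, List.length_append]
    omega
end

end DES

open DES in
/-- Theorem (co-diagnosability criterion): an FSA is not (O, T_f)-co-diagnosable
iff the concurrent composition `CC_A(S; S_1^n, …, S_L^n)` with the normal
sub-local automata contains a transition sequence
`x_0' →^{s_1'} x_1' →^{t'} x_2' →^{s_2'} x_3' →^{s_3'} x_3'` with
`x_0'` initial, `t'(0) ∈ T_f` and `|s_3'(0)| > 0`. -/
theorem not_coDiagnosable_iff_cc_witness
    {X : Type*} {T : Type*} {Λ : Type*} [Fintype X] [Fintype T] {L : ℕ}
    (A : FSA X T Λ) (Ti : Fin L → Set T) (Tf : Set T) :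
    ¬ A.CoDiagnosable (fun i => localObs A.lbl (Ti i)) Tf ↔
    ∃ (x0' x1' x2' x3' : X × (Fin L → X))
      (s1 s2 s3 : List (Option T × (Fin L → Option T)))
      (t' : Option T × (Fin L → Option T)),
      x0' ∈ ccInit A (fun i => (A.localAut (localObs A.lbl (Ti i))).normal Tf) ∧
      RunRel (ccTrans A (fun i => (A.localAut (localObs A.lbl (Ti i))).normal Tf))
        x0' s1 x1' ∧
      ccTrans A (fun i => (A.localAut (localObs A.lbl (Ti i))).normal Tf) x1' t' x2' ∧
      RunRel (ccTrans A (fun i => (A.localAut (localObs A.lbl (Ti i))).normal Tf))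
        x2' s2 x3' ∧
      RunRel (ccTrans A (fun i => (A.localAut (localObs A.lbl (Ti i))).normal Tf))
        x3' s3 x3' ∧
      (∃ tf ∈ Tf, t'.1 = some tf) ∧
      s3.filterMap (fun e => e.1) ≠ [] := by
  classical
  set B : Fin L → FSA X T Λ := fun i => (A.localAut (localObs A.lbl (Ti i))).normal Tf with hB
  constructor
  · intro hn
    simp only [FSA.CoDiagnosable] at hn
    push Not at hn
    obtain ⟨s, s', _, ⟨s1, t, ht, rfl⟩, ⟨x0, hx0, x, hrun⟩, hk, hi⟩ :=
      hn (Fintype.card (X × (Fin L → X)) + 1)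
    choose s'' hs1 hs2 hs3 using hi
    choose y0 hy0 y hy using hs1
    obtain ⟨r, q, hr, hr'⟩ := cc_build A B hrun y0 (fun i => ⟨s'' i, y i,
      run_normal (A := A.localAut (localObs A.lbl (Ti i))) (hy i) (hs3 i), hs2 i⟩)
    rw [List.append_assoc, List.filterMap_eq_append_iff] at hr'
    obtain ⟨r1, r2, rfl, _, hr2⟩ := hr'
    rw [List.singleton_append] at hr2
    obtain ⟨l1, e, l2, rfl, _, he, hl2⟩ := List.filterMap_eq_cons_iff.1 hr2
    rw [← List.append_assoc] at hr
    obtain ⟨x1, hx1, hx2⟩ := RunRel.split _ _ hr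
    cases hx2 with
    | cons hd htl =>
      rename_i x2
      obtain ⟨x3, s2, s3, h1, h2, h3⟩ := pump_cycle (fun e => e.1) x2 q l2 x2 ∅
        ⟨[], RunRel.nil _⟩ (by simp) (by rw [hl2]; simp only [Finset.card_empty]; omega) htl
      exact ⟨(x0, y0), x1, x2, x3, _, s2, s3, e, ⟨hx0, hy0⟩, hx1, hd, h1, h2, ⟨t, ht, he⟩, h3⟩
  · rintro ⟨x0, x1, x2, x3, s1, s2, s3, e, hx0, h1, hd, h2, h3, ⟨t, ht, he⟩, hne⟩ ⟨k, hk⟩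
    obtain ⟨r, hr, hrk⟩ := run_iter (fun e => e.1) h3 hne k
    have ha := h1.append (RunRel.cons hd (RunRel.nil _))
    have hall := ha.append (h2.append hr)
    have hfa : (s1 ++ [e]).filterMap (fun e => e.1) = s1.filterMap (fun e => e.1) ++ [t] := by
      rw [List.filterMap_append]; simp [he]
    obtain ⟨i, hi⟩ := hk ((s1 ++ [e]).filterMap (fun e => e.1)) ((s2 ++ r).filterMap (fun e => e.1))
      ⟨x0.1, hx0.1, _, cc_proj0 A B ha⟩ ⟨_, t, ht, hfa⟩
      ⟨x0.1, hx0.1, _, by rw [← List.filterMap_append]; exact cc_proj0 A B hall⟩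
      (by rw [List.filterMap_append, List.length_append]; omega)
    have hp := normal_run (A := A.localAut (localObs A.lbl (Ti i))) (cc_proji A B i hall)
    refine hp.2 (hi _ ⟨x0.2 i, hx0.2 i, _, hp.1⟩ ?_)
    rw [← List.filterMap_append]
    exact cc_obs A B i hall
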